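/- arXiv:1604.03155 — 2 statements merged into one kernel-verified Lean document; each statement's English description precedes it below -/
import Mathlib

section
/- Let L > 0. For every s ∈ ℝ² with s ≠ 0, writing σ = |s|, the Fourier transform of the truncated two-dimensional Laplace Green's function satisfies ∫_{|x|<L} e^{−i⟨s,x⟩} (−(1/(2π)) log|x|) dx = (1 − J₀(Lσ))/σ² − L log(L) J₁(Lσ)/σ. -/
open MeasureTheory RealInnerProductSpace

/-- The Bessel function of the first kind of integer order `n`, defined via its
integral representation `J_n(x) = (1/π) ∫₀^π cos(nθ − x sin θ) dθ`. -/
noncomputable def besselJ (n : ℕ) (x : ℝ) : ℝ :=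
  (1 / Real.pi) * ∫ θ in (0 : ℝ)..Real.pi, Real.cos (n * θ - x * Real.sin θ)

/-- Differentiation under an interval integral of a continuous integrand whose derivative in the
parameter is bounded by `1`. -/
theorem hasDerivAt_intervalIntegral_of_abs_deriv_le_one {F F' : ℝ → ℝ → ℝ} {a b : ℝ}
    (hF : ∀ x, Continuous (F x)) (hF' : ∀ x, Continuous (F' x))
    (hbound : ∀ x t, |F' x t| ≤ 1) (hderiv : ∀ x t, HasDerivAt (fun y => F y t) (F' x t) x)
    (x : ℝ) :
    HasDerivAt (fun y => ∫ t in a..b, F y t) (∫ t in a..b, F' x t) x :=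
  (intervalIntegral.hasDerivAt_integral_of_dominated_loc_of_deriv_le (bound := fun _ => 1)
    Filter.univ_mem (.of_forall fun y => (hF y).aestronglyMeasurable)
    ((hF x).intervalIntegrable _ _) (hF' x).aestronglyMeasurable
    (.of_forall fun t _ y _ => hbound y t) (continuous_const.intervalIntegrable _ _)
    (.of_forall fun t _ y _ => hderiv y t)).2

theorem besselJ_zero_eq (x : ℝ) :
    besselJ 0 x = (1 / Real.pi) * ∫ θ in (0 : ℝ)..Real.pi, Real.cos (x * Real.sin θ) := by
  simp [besselJ]

theorem besselJ_zero_zero : besselJ 0 0 = 1 := by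
  simp [besselJ_zero_eq, Real.pi_ne_zero]

theorem integral_cos_mul_cos_mul_sin (x : ℝ) :
    ∫ θ in (0 : ℝ)..Real.pi, Real.cos θ * Real.cos (x * Real.sin θ) = 0 := by
  have h := intervalIntegral.integral_comp_sub_left (a := 0) (b := Real.pi)
    (fun θ => Real.cos θ * Real.cos (x * Real.sin θ)) Real.pi
  simp only [Real.cos_pi_sub, Real.sin_pi_sub, sub_self, sub_zero, neg_mul,
    intervalIntegral.integral_neg] at h
  linarith

theorem besselJ_one_eq (x : ℝ) :
    besselJ 1 x =
      (1 / Real.pi) * ∫ θ in (0 : ℝ)..Real.pi, Real.sin θ * Real.sin (x * Real.sin θ) := by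
  simp only [besselJ, Nat.cast_one, one_mul, Real.cos_sub]
  rw [intervalIntegral.integral_add (Continuous.intervalIntegrable (by fun_prop) _ _)
    (Continuous.intervalIntegrable (by fun_prop) _ _), integral_cos_mul_cos_mul_sin, zero_add]

theorem hasDerivAt_besselJ_zero (x : ℝ) : HasDerivAt (besselJ 0) (-besselJ 1 x) x := by
  have h := (hasDerivAt_intervalIntegral_of_abs_deriv_le_one (a := 0) (b := Real.pi)
    (F := fun x θ => Real.cos (x * Real.sin θ))
    (F' := fun x θ => -(Real.sin θ * Real.sin (x * Real.sin θ)))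
    (fun x => by fun_prop) (fun x => by fun_prop)
    (fun x t => by
      rw [abs_neg, abs_mul]
      exact mul_le_one₀ (Real.abs_sin_le_one _) (abs_nonneg _) (Real.abs_sin_le_one _))
    (fun x t => by
      refine ((hasDerivAt_id' x).mul_const (Real.sin t)).cos.congr_deriv ?_
      ring) x).const_mul (1 / Real.pi)
  rw [besselJ_one_eq, ← mul_neg, ← intervalIntegral.integral_neg]
  exact h.congr_of_eventuallyEq (.of_forall besselJ_zero_eq)

theorem hasDerivAt_besselJ_one (x : ℝ) :
    HasDerivAt (besselJ 1)
      ((1 / Real.pi) * ∫ θ in (0 : ℝ)..Real.pi, Real.sin θ ^ 2 * Real.cos (x * Real.sin θ)) x := by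
  have h := (hasDerivAt_intervalIntegral_of_abs_deriv_le_one (a := 0) (b := Real.pi)
    (F := fun x θ => Real.sin θ * Real.sin (x * Real.sin θ))
    (F' := fun x θ => Real.sin θ ^ 2 * Real.cos (x * Real.sin θ))
    (fun x => by fun_prop) (fun x => by fun_prop)
    (fun x t => by
      rw [abs_mul, abs_pow]
      exact mul_le_one₀ (pow_le_one₀ (abs_nonneg _) (Real.abs_sin_le_one _)) (abs_nonneg _)
        (Real.abs_cos_le_one _))
    (fun x t => by
      refine (((hasDerivAt_id' x).mul_const (Real.sin t)).sin.const_mul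
        (Real.sin t)).congr_deriv ?_
      ring) x).const_mul (1 / Real.pi)
  exact h.congr_of_eventuallyEq (.of_forall besselJ_one_eq)

theorem besselJ_one_eq_mul_integral_cos_sq (x : ℝ) :
    besselJ 1 x =
      (1 / Real.pi) * (x * ∫ θ in (0 : ℝ)..Real.pi,
        Real.cos θ ^ 2 * Real.cos (x * Real.sin θ)) := by
  rw [besselJ_one_eq, ← sub_eq_zero, ← mul_sub, ← intervalIntegral.integral_const_mul,
    ← intervalIntegral.integral_sub (Continuous.intervalIntegrable (by fun_prop) _ _)
      (Continuous.intervalIntegrable (by fun_prop) _ _),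
    intervalIntegral.integral_eq_sub_of_hasDerivAt
      (f := fun θ => -(Real.cos θ * Real.sin (x * Real.sin θ)))
      (fun θ _ => by
        refine ((Real.hasDerivAt_cos θ).mul
          ((Real.hasDerivAt_sin θ).const_mul x).sin).neg.congr_deriv ?_
        ring)
      (Continuous.intervalIntegrable (by fun_prop) _ _)]
  simp

/-- The recurrence `(x J₁)' = x J₀`. -/
theorem hasDerivAt_id_mul_besselJ_one (x : ℝ) :
    HasDerivAt (fun y => y * besselJ 1 y) (x * besselJ 0 x) x := by
  refine ((hasDerivAt_id' x).mul (hasDerivAt_besselJ_one x)).congr_deriv ?_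
  rw [one_mul, besselJ_one_eq_mul_integral_cos_sq, besselJ_zero_eq]
  have h : ∫ θ in (0 : ℝ)..Real.pi, Real.cos (x * Real.sin θ) =
      (∫ θ in (0 : ℝ)..Real.pi, Real.cos θ ^ 2 * Real.cos (x * Real.sin θ)) +
        ∫ θ in (0 : ℝ)..Real.pi, Real.sin θ ^ 2 * Real.cos (x * Real.sin θ) := by
    rw [← intervalIntegral.integral_add (Continuous.intervalIntegrable (by fun_prop) _ _)
      (Continuous.intervalIntegrable (by fun_prop) _ _)]
    simp only [← add_mul, Real.cos_sq_add_sin_sq, one_mul]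
  rw [h]
  ring

theorem continuous_besselJ_zero : Continuous (besselJ 0) :=
  continuous_iff_continuousAt.2 fun x => (hasDerivAt_besselJ_zero x).continuousAt

theorem continuous_besselJ_one : Continuous (besselJ 1) :=
  continuous_iff_continuousAt.2 fun x => (hasDerivAt_besselJ_one x).continuousAt

/-- The Hankel transform of the logarithm on `[0, L]`. -/
theorem integral_mul_log_mul_besselJ_zero {L σ : ℝ} (hL : 0 < L) (hσ : 0 < σ) :
    ∫ r in (0 : ℝ)..L, r * Real.log r * besselJ 0 (σ * r) =
      L * Real.log L * besselJ 1 (L * σ) / σ - (1 - besselJ 0 (L * σ)) / σ ^ 2 := by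
  have hc := Real.continuous_mul_log
  have hc0 := continuous_besselJ_zero
  have hc1 := continuous_besselJ_one
  rw [intervalIntegral.integral_eq_sub_of_hasDerivAt_of_le hL.le
    (f := fun r => r * Real.log r * besselJ 1 (σ * r) / σ + besselJ 0 (σ * r) / σ ^ 2)
    (Continuous.continuousOn (by fun_prop))
    (fun r hr => ?_) (Continuous.intervalIntegrable (by fun_prop) _ _)]
  · simp only [mul_zero, besselJ_zero_zero, zero_mul, zero_div, mul_comm σ L]
    ring
  · have hlin : HasDerivAt (fun y : ℝ => σ * y) σ r := by
      simpa using (hasDerivAt_id r).const_mul σ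
    have h1 := (hasDerivAt_id_mul_besselJ_one (σ * r)).comp r hlin
    have h0 := (hasDerivAt_besselJ_zero (σ * r)).comp r hlin
    have h := (((Real.hasDerivAt_log hr.1.ne').mul h1).div_const (σ ^ 2)).add
      (h0.div_const (σ ^ 2))
    have hr0 : r ≠ 0 := hr.1.ne'
    convert h using 1
    · funext y
      simp only [Pi.add_apply, Pi.mul_apply, Function.comp_apply]
      field_simp
    · simp only [Function.comp_apply]
      field_simp
      ring

/-- The angular average of a plane wave is a Bessel function. -/
theorem integral_exp_neg_I_mul_sin (x : ℝ) :
    ∫ θ in (-Real.pi)..Real.pi, Complex.exp (-Complex.I * ((x * Real.sin θ : ℝ) : ℂ)) =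
      ((2 * Real.pi * besselJ 0 x : ℝ) : ℂ) := by
  have hc : Continuous fun θ : ℝ => Complex.exp (-Complex.I * ((x * Real.sin θ : ℝ) : ℂ)) := by
    fun_prop
  have hneg := intervalIntegral.integral_comp_neg (a := 0) (b := Real.pi)
    (fun θ : ℝ => Complex.exp (-Complex.I * ((x * Real.sin θ : ℝ) : ℂ)))
  rw [neg_zero] at hneg
  rw [← intervalIntegral.integral_add_adjacent_intervals (hc.intervalIntegrable _ 0)
    (hc.intervalIntegrable 0 _), ← hneg,
    ← intervalIntegral.integral_add (Continuous.intervalIntegrable (by fun_prop) _ _)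
      (hc.intervalIntegrable _ _)]
  have hpt : ∀ θ : ℝ, Complex.exp (-Complex.I * ((x * Real.sin (-θ) : ℝ) : ℂ)) +
      Complex.exp (-Complex.I * ((x * Real.sin θ : ℝ) : ℂ)) =
      ((2 * Real.cos (x * Real.sin θ) : ℝ) : ℂ) := by
    intro θ
    rw [Complex.ofReal_mul 2, Complex.ofReal_cos, Complex.ofReal_ofNat, Complex.two_cos,
      Real.sin_neg]
    push_cast
    ring_nf
  simp only [hpt]
  rw [intervalIntegral.integral_ofReal, intervalIntegral.integral_const_mul, besselJ_zero_eq]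
  congr 1
  field_simp

theorem exists_linearIsometryEquiv_complex_inner_eq_norm_mul_im
    {E : Type*} [NormedAddCommGroup E] [InnerProductSpace ℝ E] [FiniteDimensional ℝ E]
    (hE : Module.finrank ℝ E = 2) {s : E} (hs : s ≠ 0) :
    ∃ Φ : ℂ ≃ₗᵢ[ℝ] E, ∀ z, ⟪s, Φ z⟫ = ‖s‖ * z.im := by
  have hn : ‖s‖ ≠ 0 := norm_ne_zero_iff.2 hs
  have hv : Orthonormal ℝ (({1} : Set (Fin 2)).domRestrict fun _ => ‖s‖⁻¹ • s) := by
    refine ⟨fun i => ?_, fun i j hij => (hij (Subsingleton.elim _ _)).elim⟩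
    change ‖‖s‖⁻¹ • s‖ = 1
    rw [norm_smul, norm_inv, norm_norm, inv_mul_cancel₀ hn]
  obtain ⟨b, hb⟩ := hv.exists_orthonormalBasis_extension_of_card_eq (by simpa using hE)
  have hs' : s = ‖s‖ • b 1 := by rw [hb 1 rfl, smul_smul, mul_inv_cancel₀ hn, one_smul]
  refine ⟨Complex.isometryOfOrthonormal b, fun z => ?_⟩
  rw [Complex.isometryOfOrthonormal_apply]
  conv_lhs => rw [hs']
  simp [inner_smul_left, inner_add_right, inner_smul_right, mul_comm]

theorem setIntegral_ball_eq_complex {E F : Type*} [NormedAddCommGroup E] [InnerProductSpace ℝ E]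
    [FiniteDimensional ℝ E] [MeasurableSpace E] [BorelSpace E] [NormedAddCommGroup F]
    [NormedSpace ℝ F] (Φ : ℂ ≃ₗᵢ[ℝ] E) (f : E → F) (L : ℝ) :
    ∫ x in Metric.ball (0 : E) L, f x = ∫ z in Metric.ball (0 : ℂ) L, f (Φ z) := by
  rw [← Φ.measurePreserving.setIntegral_preimage_emb
    Φ.toHomeomorph.measurableEmbedding f]
  congr 2
  ext z
  simp

theorem Complex.setIntegral_ball_eq_polarCoord {F : Type*} [NormedAddCommGroup F]
    [NormedSpace ℝ F] (f : ℂ → F) (L : ℝ) :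
    ∫ z in Metric.ball (0 : ℂ) L, f z =
      ∫ p in Set.Ioo 0 L ×ˢ Set.Ioo (-Real.pi) Real.pi,
        p.1 • f (Complex.polarCoord.symm p) := by
  rw [← integral_indicator Metric.isOpen_ball.measurableSet,
    ← Complex.integral_comp_polarCoord_symm,
    ← integral_indicator polarCoord.open_target.measurableSet,
    ← integral_indicator (measurableSet_Ioo.prod measurableSet_Ioo)]
  congr 1
  funext p
  by_cases hp : p ∈ polarCoord.target
  · rw [Set.indicator_of_mem hp]
    have hp' : 0 < p.1 ∧ p.2 ∈ Set.Ioo (-Real.pi) Real.pi := hp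
    have hmem : Complex.polarCoord.symm p ∈ Metric.ball (0 : ℂ) L ↔ p.1 < L := by
      rw [mem_ball_zero_iff, Complex.norm_polarCoord_symm, abs_of_pos hp'.1]
    by_cases hlt : p.1 < L
    · have hmem' : p ∈ Set.Ioo 0 L ×ˢ Set.Ioo (-Real.pi) Real.pi := ⟨⟨hp'.1, hlt⟩, hp'.2⟩
      rw [Set.indicator_of_mem (hmem.2 hlt), Set.indicator_of_mem hmem']
    · rw [Set.indicator_of_notMem (mt hmem.1 hlt),
        Set.indicator_of_notMem fun h => hlt h.1.2, smul_zero]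
  · rw [Set.indicator_of_notMem hp, Set.indicator_of_notMem]
    exact fun h => hp ⟨h.1.1, h.2⟩

/-- The Fourier transform of the truncated 2D Laplace kernel `(−(1/2π) log|x|)·1_{|x|<L}`
is `(1 − J₀(Lσ))/σ² − L log(L) J₁(Lσ)/σ`, with `σ = |s|`. -/
theorem stmt_6 (L : ℝ) (hL : 0 < L)
    (s : EuclideanSpace ℝ (Fin 2)) (hs : s ≠ 0) :
    ∫ x in Metric.ball (0 : EuclideanSpace ℝ (Fin 2)) L,
        Complex.exp (-Complex.I * (⟪s, x⟫ : ℂ)) * ((-(1 / (2 * Real.pi)) * Real.log ‖x‖ : ℝ) : ℂ) =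
      (((1 - besselJ 0 (L * ‖s‖)) / ‖s‖ ^ 2 -
          L * Real.log L * besselJ 1 (L * ‖s‖) / ‖s‖ : ℝ) : ℂ) := by
  have hσ : 0 < ‖s‖ := norm_pos_iff.2 hs
  obtain ⟨Φ, hΦ⟩ := exists_linearIsometryEquiv_complex_inner_eq_norm_mul_im (by simp) hs
  rw [setIntegral_ball_eq_complex Φ, Complex.setIntegral_ball_eq_polarCoord]
  have hlog := Real.continuous_mul_log
  let g : ℝ × ℝ → ℂ := fun p =>
    ((-(1 / (2 * Real.pi)) * (p.1 * Real.log p.1) : ℝ) : ℂ) *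
      Complex.exp (-Complex.I * ((‖s‖ * p.1 * Real.sin p.2 : ℝ) : ℂ))
  have hlog' : Continuous fun p : ℝ × ℝ => p.1 * Real.log p.1 := hlog.comp continuous_fst
  have hg : Continuous g := by
    unfold g
    fun_prop
  have hgint : IntegrableOn g (Set.Ioo 0 L ×ˢ Set.Ioo (-Real.pi) Real.pi)
      ((volume : Measure ℝ).prod (volume : Measure ℝ)) :=
    (hg.continuousOn.integrableOn_compact (μ := volume)
      (isCompact_Icc.prod isCompact_Icc)).mono_set
      (Set.prod_mono Set.Ioo_subset_Icc_self Set.Ioo_subset_Icc_self)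
  rw [setIntegral_congr_fun (g := g) (measurableSet_Ioo.prod measurableSet_Ioo) fun p hp => ?_,
    Measure.volume_eq_prod, setIntegral_prod g hgint]
  · have hinner : ∀ r : ℝ, ∫ θ in Set.Ioo (-Real.pi) Real.pi, g (r, θ) =
        ((-(r * Real.log r * besselJ 0 (‖s‖ * r)) : ℝ) : ℂ) := by
      intro r
      rw [← integral_Ioc_eq_integral_Ioo,
        ← intervalIntegral.integral_of_le (by linarith [Real.pi_pos])]
      simp only [g]
      rw [intervalIntegral.integral_const_mul, integral_exp_neg_I_mul_sin, ← Complex.ofReal_mul]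
      congr 1
      field_simp
    simp only [hinner]
    rw [← integral_Ioc_eq_integral_Ioo, ← intervalIntegral.integral_of_le hL.le,
      intervalIntegral.integral_ofReal, intervalIntegral.integral_neg,
      integral_mul_log_mul_besselJ_zero hL hσ, neg_sub]
  · have him : (Complex.polarCoord.symm p).im = p.1 * Real.sin p.2 := by
      simp [Complex.polarCoord_symm_apply, -Complex.ofReal_sin, -Complex.ofReal_cos]
    simp only [hΦ, LinearIsometryEquiv.norm_map, Complex.norm_polarCoord_symm, him,
      abs_of_pos hp.1.1, Complex.real_smul, g]
    push_cast
    ring_nf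
end

section
/- Let D = [-1/2,1/2]³ and let L > √3. Let f : ℝ³ → ℂ be smooth with support contained in D, and define F(s) = ∫_{ℝ³} e^{−i⟨s,y⟩} f(y) dy. Then for every x ∈ D, the Coulomb volume potential admits the spectral representation ∫_D (1/(4π|x−y|)) f(y) dy = (1/(2π)³) ∫_{ℝ³} e^{i⟨s,x⟩} · 2 (sin(L|s|/2)/|s|)² · F(s) ds, the integrand on the right being absolutely integrable. -/
open MeasureTheory RealInnerProductSpace

/-- The radial profile of the Coulomb kernel truncated at radius `L`. -/
noncomputable def truncatedCoulomb (L r : ℝ) : ℝ :=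
  (Set.Iic L).indicator (fun r => 1 / (4 * Real.pi * r)) r

lemma integrable_truncatedCoulomb_norm (L : ℝ) :
    Integrable (fun z : EuclideanSpace ℝ (Fin 3) => truncatedCoulomb L ‖z‖) := by
  rw [integrable_fun_norm_addHaar]
  have h : IntegrableOn (fun y : ℝ => y / (4 * Real.pi)) (Set.Ioc 0 L) :=
    (by fun_prop : Continuous fun y : ℝ => y / (4 * Real.pi)).integrableOn_Ioc
  rw [← integrable_indicator_iff measurableSet_Ioc] at h
  refine (h.integrableOn (s := Set.Ioi 0)).congr_fun ?_ measurableSet_Ioi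
  intro y hy
  have hy : 0 < y := hy
  have hpi := Real.pi_pos
  by_cases hyL : y ≤ L
  · simp only [truncatedCoulomb, Set.indicator, Set.mem_Ioc, Set.mem_Iic, hy, hyL]
    simp
    field_simp
  · simp [truncatedCoulomb, hyL]

lemma integral_truncatedCoulomb_sqrt {L t : ℝ} (ht : t ≠ 0) :
    ∫ y in Set.Ioi (0 : ℝ), y * truncatedCoulomb L (√(t ^ 2 + y ^ 2)) =
      max (L - |t|) 0 / (4 * Real.pi) := by
  have hpi := Real.pi_pos
  have ht2 : 0 < t ^ 2 := by positivity
  rcases le_or_gt L |t| with h | h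
  · rw [max_eq_right (by linarith), zero_div]
    refine setIntegral_eq_zero_of_forall_eq_zero fun y hy => ?_
    have hy : 0 < y := hy
    have : |t| < √(t ^ 2 + y ^ 2) := by
      rw [← Real.sqrt_sq_eq_abs]
      exact Real.sqrt_lt_sqrt ht2.le (by nlinarith)
    simp [truncatedCoulomb, h.trans_lt this]
  · have hL : 0 < L := (abs_nonneg t).trans_lt h
    have htL : t ^ 2 < L ^ 2 := by
      rw [← sq_abs t]; exact pow_lt_pow_left₀ h (abs_nonneg t) two_ne_zero
    set R := √(L ^ 2 - t ^ 2) with hR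
    have hR2 : R ^ 2 = L ^ 2 - t ^ 2 := Real.sq_sqrt (by linarith)
    have hR0 : 0 ≤ R := Real.sqrt_nonneg _
    have hiff (y : ℝ) (hy : 0 < y) : √(t ^ 2 + y ^ 2) ≤ L ↔ y ≤ R := by
      rw [Real.sqrt_le_left hL.le, hR, Real.le_sqrt' hy]
      constructor <;> intro h <;> linarith
    have hderiv (y : ℝ) : HasDerivAt (fun y => √(t ^ 2 + y ^ 2) / (4 * Real.pi))
        (y * (1 / (4 * Real.pi * √(t ^ 2 + y ^ 2)))) y := by
      have h1 : HasDerivAt (fun y : ℝ => t ^ 2 + y ^ 2) (2 * y) y := by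
        simpa using (hasDerivAt_pow 2 y).const_add (t ^ 2)
      have hpos : 0 < t ^ 2 + y ^ 2 := by positivity
      refine ((h1.sqrt hpos.ne').div_const (4 * Real.pi)).congr_deriv ?_
      have := Real.sqrt_pos.2 hpos
      field_simp
    calc ∫ y in Set.Ioi (0 : ℝ), y * truncatedCoulomb L (√(t ^ 2 + y ^ 2))
        = ∫ y in Set.Ioi (0 : ℝ), (Set.Ioc 0 R).indicator
            (fun y => y * (1 / (4 * Real.pi * √(t ^ 2 + y ^ 2)))) y := by
          refine setIntegral_congr_fun measurableSet_Ioi fun y hy => ?_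
          have hy : 0 < y := hy
          by_cases hyR : y ≤ R
          · have := (hiff y hy).2 hyR
            simp [truncatedCoulomb, hyR, hy, this]
          · have := (hiff y hy).not.2 hyR
            simp only [truncatedCoulomb, Set.indicator, Set.mem_Iic, Set.mem_Ioc, this, hyR]
            simp
      _ = ∫ y in (0 : ℝ)..R, y * (1 / (4 * Real.pi * √(t ^ 2 + y ^ 2))) := by
          rw [setIntegral_indicator measurableSet_Ioc, intervalIntegral.integral_of_le hR0,
            Set.inter_eq_right.2 Set.Ioc_subset_Ioi_self]
      _ = _ := by
          rw [intervalIntegral.integral_eq_sub_of_hasDerivAt (fun y _ => hderiv y), hR2,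
            add_sub_cancel, Real.sqrt_sq hL.le, max_eq_left (by linarith)]
          · simp [Real.sqrt_sq_eq_abs]
            ring
          · refine Continuous.intervalIntegrable ?_ _ _
            refine continuous_id.mul (continuous_const.div (by fun_prop) fun y => ?_)
            have hpos : 0 < t ^ 2 + y ^ 2 := by positivity
            have := Real.sqrt_pos.2 hpos
            positivity

lemma integral_truncatedCoulomb_slice {L t : ℝ} (ht : t ≠ 0) :
    ∫ w : EuclideanSpace ℝ (Fin 2), truncatedCoulomb L (√(t ^ 2 + ‖w‖ ^ 2)) =
      max (L - |t|) 0 / 2 := by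
  rw [integral_fun_norm_addHaar volume (fun y => truncatedCoulomb L (√(t ^ 2 + y ^ 2)))]
  have := integral_truncatedCoulomb_sqrt (L := L) ht
  simp only [finrank_euclideanSpace_fin, Nat.add_one_sub_one, pow_one, smul_eq_mul, this,
    Measure.real, EuclideanSpace.volume_ball_fin_two]
  have hpi := Real.pi_pos
  simp [Real.pi_pos.le]
  field_simp
  ring

lemma integral_exp_mul_sub {c : ℂ} (hc : c ≠ 0) (L : ℝ) :
    ∫ t in (0 : ℝ)..L, Complex.exp (c * t) * (L - t) =
      (Complex.exp (c * L) - 1) / c ^ 2 - L / c := by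
  have hderiv (t : ℝ) : HasDerivAt
      (fun t : ℝ => Complex.exp (c * t) * ((L - t) / c + 1 / c ^ 2))
      (Complex.exp (c * t) * (L - t)) t := by
    have h1 : HasDerivAt (fun t : ℂ => Complex.exp (c * t) * ((L - t) / c + 1 / c ^ 2))
        (Complex.exp (c * t) * (L - t)) (t : ℂ) := by
      have h2 : HasDerivAt (fun t : ℂ => Complex.exp (c * t)) (Complex.exp (c * t) * c) (t : ℂ) := by
        simpa using ((hasDerivAt_id (t : ℂ)).const_mul c).cexp
      have h3 : HasDerivAt (fun t : ℂ => ((L - t) / c + 1 / c ^ 2)) (-1 / c) (t : ℂ) := by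
        simpa using (((hasDerivAt_id (t : ℂ)).const_sub (L : ℂ)).div_const c).add_const (1 / c ^ 2)
      refine (h2.mul h3).congr_deriv ?_
      field_simp
      ring
    exact h1.comp_ofReal
  rw [intervalIntegral.integral_eq_sub_of_hasDerivAt (fun t _ => hderiv t)
    (Continuous.intervalIntegrable (by fun_prop) _ _)]
  simp
  field_simp
  ring

lemma integral_exp_mul_tent {σ L : ℝ} (hσ : σ ≠ 0) (hL : 0 < L) :
    ∫ t : ℝ, Complex.exp (-Complex.I * (σ * t : ℝ)) * (max (L - |t|) 0 / 2 : ℝ) =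
      ((2 * (Real.sin (L * σ / 2) / σ) ^ 2 : ℝ) : ℂ) := by
  set g : ℝ → ℂ := fun t => Complex.exp (-Complex.I * (σ * t : ℝ)) * (max (L - |t|) 0 / 2 : ℝ)
    with hg
  have hcont : Continuous g := by fun_prop
  have hzero : ∀ t ∉ Set.Ioc (-L) L, g t = 0 := by
    intro t ht
    have : L ≤ |t| := by
      by_contra! h
      exact ht ⟨(abs_lt.1 h).1, (abs_lt.1 h).2.le⟩
    simp [hg, this]
  have hσ' : (σ : ℂ) ≠ 0 := by exact_mod_cast hσ
  have hcI : Complex.I * σ ≠ 0 := mul_ne_zero Complex.I_ne_zero hσ'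
  have hpos : ∫ t in (0 : ℝ)..L, g t =
      ((Complex.exp (-(Complex.I * σ) * L) - 1) / (-(Complex.I * σ)) ^ 2
        - L / (-(Complex.I * σ))) / 2 := by
    rw [← integral_exp_mul_sub (neg_ne_zero.2 hcI), ← intervalIntegral.integral_div]
    refine intervalIntegral.integral_congr fun t ht => ?_
    rw [Set.uIcc_of_le hL.le] at ht
    have h : max (L - |t|) 0 = L - t := by
      rw [abs_of_nonneg ht.1, max_eq_left (by linarith [ht.2])]
    simp only [hg, h]
    push_cast
    ring_nf
  have hneg : ∫ t in (-L)..0, g t =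
      ((Complex.exp ((Complex.I * σ) * L) - 1) / (Complex.I * σ) ^ 2
        - L / (Complex.I * σ)) / 2 := by
    rw [← integral_exp_mul_sub hcI, ← intervalIntegral.integral_div]
    have := intervalIntegral.integral_comp_neg (a := 0) (b := L) g
    rw [neg_zero] at this
    rw [← this]
    refine intervalIntegral.integral_congr fun t ht => ?_
    rw [Set.uIcc_of_le hL.le] at ht
    have h : max (L - |(-t)|) 0 = L - t := by
      rw [abs_neg, abs_of_nonneg ht.1, max_eq_left (by linarith [ht.2])]
    simp only [hg, h]
    push_cast
    ring_nf
  rw [← setIntegral_eq_integral_of_forall_compl_eq_zero hzero,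
    ← intervalIntegral.integral_of_le (by linarith),
    ← intervalIntegral.integral_add_adjacent_intervals (b := 0)
      (hcont.intervalIntegrable _ _) (hcont.intervalIntegrable _ _), hpos, hneg]
  have hsin : Complex.sin ((L : ℂ) * σ / 2) ^ 2 = 1 / 2 - Complex.cos (L * σ) / 2 := by
    rw [Complex.sin_sq, Complex.cos_sq]
    ring_nf
  push_cast
  rw [div_pow, hsin, Complex.cos]
  have hI2 : Complex.I ^ 2 = -1 := Complex.I_sq
  rw [neg_sq, mul_pow, hI2, show (Complex.I * σ) * L = L * σ * Complex.I by ring,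
    show -(Complex.I * σ) * L = -(L * σ) * Complex.I by ring]
  field_simp
  ring

lemma integral_coord_norm_eq_integral_slice (g : ℝ → ℝ → ℂ)
    (hg : Integrable fun z : EuclideanSpace ℝ (Fin 3) => g (z 0) ‖z‖) :
    ∫ z : EuclideanSpace ℝ (Fin 3), g (z 0) ‖z‖ =
      ∫ t : ℝ, ∫ w : EuclideanSpace ℝ (Fin 2), g t (√(t ^ 2 + ‖w‖ ^ 2)) := by
  let e : EuclideanSpace ℝ (Fin 3) ≃ᵐ ℝ × EuclideanSpace ℝ (Fin 2) :=
    ((MeasurableEquiv.toLp 2 (Fin 3 → ℝ)).symm.trans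
      (MeasurableEquiv.piFinSuccAbove (fun _ : Fin 3 => ℝ) 0)).trans
      ((MeasurableEquiv.refl ℝ).prodCongr (MeasurableEquiv.toLp 2 (Fin 2 → ℝ)))
  have he : MeasurePreserving e volume volume :=
    ((MeasurePreserving.id volume).prod (PiLp.volume_preserving_toLp (Fin 2))).comp
      ((volume_preserving_piFinSuccAbove (fun _ : Fin 3 => ℝ) 0).comp
        (PiLp.volume_preserving_ofLp (Fin 3)))
  let G : ℝ × EuclideanSpace ℝ (Fin 2) → ℂ := fun p => g p.1 (√(p.1 ^ 2 + ‖p.2‖ ^ 2))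
  have hG : ∀ z, G (e z) = g (z 0) ‖z‖ := by
    intro z
    have h1 : (e z).1 = z 0 := rfl
    have h2 : ‖(e z).2‖ ^ 2 = z 1 ^ 2 + z 2 ^ 2 := by
      rw [EuclideanSpace.real_norm_sq_eq, Fin.sum_univ_two]
      rfl
    have h3 : ‖z‖ = √(z 0 ^ 2 + (z 1 ^ 2 + z 2 ^ 2)) := by
      rw [EuclideanSpace.norm_eq, Fin.sum_univ_three]
      simp [add_assoc]
    simp only [G, h1, h2, h3]
  simp_rw [← hG] at hg ⊢
  rw [he.integral_comp' G]
  have hGi : Integrable G (volume.prod volume) := (he.integrable_comp_emb e.measurableEmbedding).1 hg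
  exact integral_prod G hGi

lemma norm_exp_neg_I_mul_ofReal (a : ℝ) : ‖Complex.exp (-Complex.I * a)‖ = 1 := by
  rw [Complex.norm_exp]
  simp

lemma norm_exp_I_mul_ofReal (a : ℝ) : ‖Complex.exp (Complex.I * a)‖ = 1 := by
  rw [Complex.norm_exp]
  simp

lemma integral_exp_mul_truncatedCoulomb {L : ℝ} (hL : 0 < L) {s : EuclideanSpace ℝ (Fin 3)}
    (hs : s ≠ 0) :
    ∫ z : EuclideanSpace ℝ (Fin 3),
        Complex.exp (-Complex.I * (⟪s, z⟫ : ℂ)) * truncatedCoulomb L ‖z‖ =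
      ((2 * (Real.sin (L * ‖s‖ / 2) / ‖s‖) ^ 2 : ℝ) : ℂ) := by
  set v : EuclideanSpace ℝ (Fin 3) := EuclideanSpace.single 0 ‖s‖ with hv
  have hnorm : ‖v‖ = ‖s‖ := by simp [hv]
  set R := (Submodule.span ℝ {v - s})ᗮ.reflection with hR
  have hRv : R v = s := Submodule.reflection_sub hnorm
  have hinner (z : EuclideanSpace ℝ (Fin 3)) : ⟪s, R z⟫ = ‖s‖ * z 0 := by
    rw [← hRv, R.inner_map_map, hv, EuclideanSpace.inner_single_left, hRv]
    simp
  have hint : Integrable fun z : EuclideanSpace ℝ (Fin 3) =>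
      Complex.exp (-Complex.I * (‖s‖ * z 0 : ℝ)) * truncatedCoulomb L ‖z‖ := by
    refine (integrable_truncatedCoulomb_norm L).ofReal.bdd_mul (c := 1) ?_ ?_
    · exact Continuous.aestronglyMeasurable (by fun_prop)
    · exact Filter.Eventually.of_forall fun z => (norm_exp_neg_I_mul_ofReal _).le
  calc _ = ∫ z : EuclideanSpace ℝ (Fin 3),
        Complex.exp (-Complex.I * (‖s‖ * z 0 : ℝ)) * truncatedCoulomb L ‖z‖ := by
        rw [← R.measurePreserving.integral_comp R.toHomeomorph.measurableEmbedding]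
        simp only [hinner, R.norm_map]
    _ = ∫ t : ℝ, ∫ w : EuclideanSpace ℝ (Fin 2), Complex.exp (-Complex.I * (‖s‖ * t : ℝ)) *
          truncatedCoulomb L (√(t ^ 2 + ‖w‖ ^ 2)) :=
        integral_coord_norm_eq_integral_slice
          (fun t r => Complex.exp (-Complex.I * (‖s‖ * t : ℝ)) * truncatedCoulomb L r) hint
    _ = ∫ t : ℝ, Complex.exp (-Complex.I * (‖s‖ * t : ℝ)) * (max (L - |t|) 0 / 2 : ℝ) := by
        refine integral_congr_ae ?_
        filter_upwards [compl_mem_ae_iff.2 (measure_singleton (0 : ℝ))] with t ht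
        have ht : t ≠ 0 := ht
        rw [integral_const_mul, integral_complex_ofReal, integral_truncatedCoulomb_slice ht]
    _ = _ := integral_exp_mul_tent (norm_ne_zero_iff.2 hs) hL

/-- Fourier inversion for compactly supported smooth functions, with the transform normalised as
`F s = ∫ exp (-i⟨s, y⟩) f y`. -/
lemma integrable_and_inversion_of_contDiff_hasCompactSupport
    {f F : EuclideanSpace ℝ (Fin 3) → ℂ} (hf : ContDiff ℝ (⊤ : ℕ∞) f) (hc : HasCompactSupport f)
    (hF : ∀ s, F s = ∫ y, Complex.exp (-Complex.I * (⟪s, y⟫ : ℂ)) * f y) :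
    Integrable F ∧ ∀ w, f w = ((1 / (2 * Real.pi) ^ 3 : ℝ) : ℂ) *
      ∫ s, Complex.exp (Complex.I * (⟪s, w⟫ : ℂ)) * F s := by
  have hpi := Real.pi_pos
  let φ : SchwartzMap (EuclideanSpace ℝ (Fin 3)) ℂ := hc.toSchwartzMap hf
  have hφ : (φ : EuclideanSpace ℝ (Fin 3) → ℂ) = f := rfl
  have hFφ : ∀ ξ, F ((2 * Real.pi) • ξ) = FourierTransform.fourier f ξ := by
    intro ξ
    rw [hF, Real.fourier_eq']
    refine integral_congr_ae (Filter.Eventually.of_forall fun y => ?_)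
    simp only [smul_eq_mul, real_inner_smul_left, real_inner_comm y ξ]
    push_cast
    ring_nf
  have hint : Integrable (FourierTransform.fourier f) := by
    rw [← hφ, ← SchwartzMap.fourier_coe]
    exact SchwartzMap.integrable _
  refine ⟨?_, fun w => ?_⟩
  · rw [← integrable_comp_smul_iff volume F (R := 2 * Real.pi) (by positivity)]
    simpa only [hFφ] using hint
  · have hinv := congrFun (hf.continuous.fourierInv_fourier_eq (hφ ▸ φ.integrable) hint) w
    rw [← hinv, Real.fourierInv_eq']
    have := Measure.integral_comp_smul volume
      (fun s => Complex.exp (Complex.I * (⟪s, w⟫ : ℂ)) * F s) (2 * Real.pi)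
    simp only [hFφ, finrank_euclideanSpace_fin] at this
    rw [abs_of_pos (by positivity), Complex.real_smul] at this
    rw [one_div, ← this]
    refine integral_congr_ae (Filter.Eventually.of_forall fun y => ?_)
    simp only [smul_eq_mul, real_inner_smul_left]
    push_cast
    ring_nf

lemma norm_sub_le_sqrt_three_of_mem_box {x y : EuclideanSpace ℝ (Fin 3)}
    (hx : ∀ i, x i ∈ Set.Icc (-(1 / 2) : ℝ) (1 / 2))
    (hy : ∀ i, y i ∈ Set.Icc (-(1 / 2) : ℝ) (1 / 2)) : ‖x - y‖ ≤ √3 := by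
  rw [EuclideanSpace.norm_eq]
  refine Real.sqrt_le_sqrt ?_
  have h (i : Fin 3) : ‖(x - y) i‖ ^ 2 ≤ 1 := by
    rw [PiLp.sub_apply, Real.norm_eq_abs, sq_abs, sq_le_one_iff_abs_le_one, abs_le]
    constructor <;> linarith [(hx i).1, (hx i).2, (hy i).1, (hy i).2]
  calc ∑ i, ‖(x - y) i‖ ^ 2 ≤ ∑ _i : Fin 3, (1 : ℝ) := Finset.sum_le_sum fun i _ => h i
    _ = 3 := by simp

lemma isCompact_box :
    IsCompact {y : EuclideanSpace ℝ (Fin 3) | ∀ i, y i ∈ Set.Icc (-(1 / 2) : ℝ) (1 / 2)} := by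
  refine Metric.isCompact_of_isClosed_isBounded ?_ ?_
  · simp only [Set.ofPred_forall]
    exact isClosed_iInter fun i => isClosed_Icc.preimage (by fun_prop)
  · refine (Metric.isBounded_closedBall (x := 0) (r := √3)).subset fun y hy => ?_
    rw [mem_closedBall_zero_iff, ← sub_zero y]
    exact norm_sub_le_sqrt_three_of_mem_box hy fun i => by norm_num

/-- The Fourier symbol `2 (sin (L|s|/2) / |s|)²` is bounded by `L² / 2`. -/
lemma norm_truncatedCoulomb_symbol_le (L r : ℝ) :
    ‖((2 * (Real.sin (L * r / 2) / r) ^ 2 : ℝ) : ℂ)‖ ≤ L ^ 2 / 2 := by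
  rw [Complex.norm_real, Real.norm_of_nonneg (by positivity)]
  rcases eq_or_ne r 0 with rfl | hr
  · simp; positivity
  · have h : Real.sin (L * r / 2) ^ 2 ≤ (L * r / 2) ^ 2 := sq_le_sq.2 Real.abs_sin_le_abs
    have hr2 : 0 < r ^ 2 := by positivity
    rw [div_pow, ← mul_div_assoc, div_le_iff₀ hr2]
    linarith

/-- Spectral representation of the Coulomb volume potential on the unit box using the
truncated kernel: for smooth `f` supported in `D = [-1/2,1/2]³` and `L > √3`, and all
`x ∈ D`,
`∫_D (1/(4π|x−y|)) f(y) dy = (1/(2π)³) ∫_{ℝ³} e^{i⟨s,x⟩} · 2(sin(L|s|/2)/|s|)² · F(s) ds`,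
the integrand on the right being absolutely integrable. -/
theorem stmt_11 (L : ℝ) (hL : Real.sqrt 3 < L)
    (D : Set (EuclideanSpace ℝ (Fin 3)))
    (hD : D = {y : EuclideanSpace ℝ (Fin 3) | ∀ i, y i ∈ Set.Icc (-(1 / 2) : ℝ) (1 / 2)})
    (f : EuclideanSpace ℝ (Fin 3) → ℂ)
    (hf : ContDiff ℝ (⊤ : ℕ∞) f) (hsupp : Function.support f ⊆ D)
    (F : EuclideanSpace ℝ (Fin 3) → ℂ)
    (hF : ∀ s, F s = ∫ y, Complex.exp (-Complex.I * (⟪s, y⟫ : ℂ)) * f y)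
    (x : EuclideanSpace ℝ (Fin 3)) (hx : x ∈ D) :
    Integrable (fun s : EuclideanSpace ℝ (Fin 3) =>
        Complex.exp (Complex.I * (⟪s, x⟫ : ℂ)) *
          ((2 * (Real.sin (L * ‖s‖ / 2) / ‖s‖) ^ 2 : ℝ) : ℂ) * F s) ∧
    ∫ y in D, ((1 / (4 * Real.pi * ‖x - y‖) : ℝ) : ℂ) * f y =
      ((1 / (2 * Real.pi) ^ 3 : ℝ) : ℂ) *
        ∫ s, Complex.exp (Complex.I * (⟪s, x⟫ : ℂ)) *
          ((2 * (Real.sin (L * ‖s‖ / 2) / ‖s‖) ^ 2 : ℝ) : ℂ) * F s := by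
  subst hD
  have hL0 : 0 < L := (Real.sqrt_nonneg 3).trans_lt hL
  obtain ⟨hFint, hinv⟩ := integrable_and_inversion_of_contDiff_hasCompactSupport hf
    (HasCompactSupport.of_support_subset_isCompact isCompact_box hsupp) hF
  refine ⟨hFint.bdd_mul (c := L ^ 2 / 2) ?_ (Filter.Eventually.of_forall fun s => ?_), ?_⟩
  · exact Measurable.aestronglyMeasurable (by fun_prop)
  · rw [norm_mul, norm_exp_I_mul_ofReal, one_mul]
    exact norm_truncatedCoulomb_symbol_le L ‖s‖
  have hprod : Integrable (Function.uncurry fun z s : EuclideanSpace ℝ (Fin 3) =>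
      (truncatedCoulomb L ‖z‖ : ℂ) * (Complex.exp (Complex.I * (⟪s, x - z⟫ : ℂ)) * F s))
      (volume.prod volume) := by
    have h := ((integrable_truncatedCoulomb_norm L).ofReal (𝕜 := ℂ)).mul_prod hFint
    refine (h.bdd_mul (c := 1)
      (f := fun p => Complex.exp (Complex.I * (⟪p.2, x - p.1⟫ : ℂ))) ?_ ?_).congr ?_
    · exact Continuous.aestronglyMeasurable (by fun_prop)
    · exact Filter.Eventually.of_forall fun p => (norm_exp_I_mul_ofReal _).le
    · refine Filter.Eventually.of_forall fun p => ?_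
      simp only [Function.uncurry, RCLike.ofReal_eq_complex_ofReal]
      ring
  calc _ = ∫ y, (truncatedCoulomb L ‖x - y‖ : ℂ) * f y := by
        have hzero (y : EuclideanSpace ℝ (Fin 3))
            (hy : y ∉ {y : EuclideanSpace ℝ (Fin 3) |
              ∀ i, y i ∈ Set.Icc (-(1 / 2) : ℝ) (1 / 2)}) :
            (truncatedCoulomb L ‖x - y‖ : ℂ) * f y = 0 := by
          rw [Function.notMem_support.1 fun h => hy (hsupp h), mul_zero]
        rw [← setIntegral_eq_integral_of_forall_compl_eq_zero hzero]
        refine setIntegral_congr_fun isCompact_box.measurableSet fun y hy => ?_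
        have hxy : ‖x - y‖ ≤ L := (norm_sub_le_sqrt_three_of_mem_box hx hy).trans hL.le
        simp only [truncatedCoulomb, Set.indicator, Set.mem_Iic, hxy, if_true]
    _ = ∫ z, (truncatedCoulomb L ‖z‖ : ℂ) * f (x - z) := by
        rw [← integral_sub_left_eq_self (fun y => (truncatedCoulomb L ‖x - y‖ : ℂ) * f y) volume x]
        simp only [sub_sub_cancel]
    _ = ((1 / (2 * Real.pi) ^ 3 : ℝ) : ℂ) * ∫ z, ∫ s, (truncatedCoulomb L ‖z‖ : ℂ) *
          (Complex.exp (Complex.I * (⟪s, x - z⟫ : ℂ)) * F s) := by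
        rw [← integral_const_mul]
        refine integral_congr_ae (Filter.Eventually.of_forall fun z => ?_)
        simp only [integral_const_mul]
        rw [hinv (x - z)]
        ring
    _ = _ := by
        rw [integral_integral_swap hprod]
        congr 1
        refine integral_congr_ae ?_
        filter_upwards [compl_mem_ae_iff.2 (measure_singleton (0 : EuclideanSpace ℝ (Fin 3)))]
          with s hs
        have hs : s ≠ 0 := hs
        rw [← integral_exp_mul_truncatedCoulomb hL0 hs, ← integral_const_mul,
          ← integral_mul_const]
        refine integral_congr_ae (Filter.Eventually.of_forall fun z => ?_)
        have h : Complex.exp (Complex.I * (⟪s, x - z⟫ : ℂ)) =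
            Complex.exp (Complex.I * (⟪s, x⟫ : ℂ)) * Complex.exp (-Complex.I * (⟪s, z⟫ : ℂ)) := by
          rw [← Complex.exp_add, inner_sub_right]
          push_cast
          ring_nf
        simp only [h]
        ring
end
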